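/- Let C be a coalgebra over a field k and M a left C-comodule with coaction ρ. Suppose T : M → M is a left C-comodule map such that (M,T) is a generic Rota-Baxter paired C-comodule of weight -1. Then M decomposes as a direct sum of C-subcomodules M = M₁ ⊕ M₂, where M₁ = T(M) and M₂ = (id - T)(M) are C-subcomodules of M, and T is the projection of M onto M₁ along M₂ (T(m₁ + m₂) = m₁ for m₁ ∈ M₁, m₂ ∈ M₂). Conversely, if M = M₁ ⊕ M₂ is a direct sum of C-subcomodules and T : M → M is the projection onto M₁ along M₂, then T is a left C-comodule map and (M,T) is a generic Rota-Baxter paired C-comodule of weight -1. -/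

import Mathlib

open TensorProduct

/-- The Rota-Baxter paired left comodule condition of weight `lam`. -/
def RBPairedComodule {k C M : Type*} [Field k] [AddCommGroup C] [Module k C]
    [AddCommGroup M] [Module k M] (ρ : M →ₗ[k] C ⊗[k] M)
    (P : C →ₗ[k] C) (T : M →ₗ[k] M) (lam : k) : Prop :=
  TensorProduct.map P T ∘ₗ ρ =
    TensorProduct.map P LinearMap.id ∘ₗ ρ ∘ₗ T +
      TensorProduct.map LinearMap.id T ∘ₗ ρ ∘ₗ T + lam • (ρ ∘ₗ T)

/-- `N` is a `C`-subcomodule of `M`: `ρ(N) ⊆ C ⊗ N`. -/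
def IsSubcomodule {k C M : Type*} [Field k] [AddCommGroup C] [Module k C]
    [AddCommGroup M] [Module k M] (ρ : M →ₗ[k] C ⊗[k] M) (N : Submodule k M) : Prop :=
  ∀ m ∈ N, ρ m ∈ LinearMap.range (TensorProduct.map (LinearMap.id : C →ₗ[k] C) N.subtype)

/-- The range of a comodule endomorphism is a subcomodule. -/
theorem isSubcomodule_range {k C M : Type*} [Field k] [AddCommGroup C] [Module k C]
    [AddCommGroup M] [Module k M] {ρ : M →ₗ[k] C ⊗[k] M} {f : M →ₗ[k] M}
    (hf : ρ ∘ₗ f = TensorProduct.map LinearMap.id f ∘ₗ ρ) :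
    IsSubcomodule ρ (LinearMap.range f) := by
  rintro _ ⟨m, rfl⟩
  refine ⟨TensorProduct.map LinearMap.id f.rangeRestrict (ρ m), ?_⟩
  rw [← LinearMap.comp_apply, ← TensorProduct.map_comp, LinearMap.subtype_comp_codRestrict,
    LinearMap.id_comp]
  exact (LinearMap.congr_fun hf m).symm

/-- If an endomorphism `T` acts on a subcomodule `N` as the restriction of a comodule
endomorphism `g`, then it commutes with the coaction on `N`. -/
theorem IsSubcomodule.coaction_apply_of_eqOn {k C M : Type*} [Field k] [AddCommGroup C]
    [Module k C] [AddCommGroup M] [Module k M] {ρ : M →ₗ[k] C ⊗[k] M} {N : Submodule k M}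
    (hN : IsSubcomodule ρ N) {T g : M →ₗ[k] M}
    (hg : ρ ∘ₗ g = TensorProduct.map LinearMap.id g ∘ₗ ρ)
    (h : ∀ m ∈ N, T m = g m) {m : M} (hm : m ∈ N) :
    ρ (T m) = TensorProduct.map LinearMap.id T (ρ m) := by
  have hsub : T ∘ₗ N.subtype = g ∘ₗ N.subtype := LinearMap.ext fun x => h x x.2
  have hgm : ρ (g m) = TensorProduct.map LinearMap.id g (ρ m) := LinearMap.congr_fun hg m
  obtain ⟨x, hx⟩ := hN m hm
  rw [h m hm, hgm, ← hx, ← LinearMap.comp_apply, ← LinearMap.comp_apply,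
    ← TensorProduct.map_comp, ← TensorProduct.map_comp, hsub]

theorem stmt1 {k C M : Type*} [Field k] [AddCommGroup C] [Module k C] [Coalgebra k C]
    [AddCommGroup M] [Module k M] (ρ : M →ₗ[k] C ⊗[k] M)
    -- `M` is a left `C`-comodule:
    (hcoassoc : (TensorProduct.assoc k C C M).toLinearMap ∘ₗ
        TensorProduct.map Coalgebra.comul LinearMap.id ∘ₗ ρ =
        TensorProduct.map LinearMap.id ρ ∘ₗ ρ)
    (hcounit : (TensorProduct.lid k M).toLinearMap ∘ₗ
        TensorProduct.map Coalgebra.counit LinearMap.id ∘ₗ ρ = LinearMap.id)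
    (T : M →ₗ[k] M) :
    -- Forward direction: if `T` is a comodule map and `(M,T)` is a generic Rota-Baxter
    -- paired `C`-comodule of weight `-1`, then `M = T(M) ⊕ (id - T)(M)` is a direct sum
    -- of `C`-subcomodules and `T` is the projection onto `T(M)` along `(id - T)(M)`.
    ((ρ ∘ₗ T = TensorProduct.map LinearMap.id T ∘ₗ ρ ∧
        (∀ P : C →ₗ[k] C, RBPairedComodule ρ P T (-1))) →
      (IsCompl (LinearMap.range T) (LinearMap.range (LinearMap.id - T)) ∧
        IsSubcomodule ρ (LinearMap.range T) ∧
        IsSubcomodule ρ (LinearMap.range (LinearMap.id - T)) ∧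
        ∀ m₁ ∈ LinearMap.range T, ∀ m₂ ∈ LinearMap.range (LinearMap.id - T),
          T (m₁ + m₂) = m₁)) ∧
    -- Converse: if `M = M₁ ⊕ M₂` is a direct sum of `C`-subcomodules and `T` is the
    -- projection onto `M₁` along `M₂`, then `T` is a comodule map and `(M,T)` is a
    -- generic Rota-Baxter paired `C`-comodule of weight `-1`.
    (∀ M₁ M₂ : Submodule k M, IsCompl M₁ M₂ → IsSubcomodule ρ M₁ → IsSubcomodule ρ M₂ →
      (∀ m₁ ∈ M₁, ∀ m₂ ∈ M₂, T (m₁ + m₂) = m₁) →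
      (ρ ∘ₗ T = TensorProduct.map LinearMap.id T ∘ₗ ρ ∧
        ∀ P : C →ₗ[k] C, RBPairedComodule ρ P T (-1))) := by
  constructor
  · rintro ⟨hT, hRB⟩
    have hinj : Function.Injective ρ := by
      intro x y hxy
      have hx := LinearMap.congr_fun hcounit x
      have hy := LinearMap.congr_fun hcounit y
      simp only [LinearMap.comp_apply, LinearMap.id_apply] at hx hy
      rw [← hx, ← hy, hxy]
    have hTT : ∀ m, T (T m) = T m := by
      intro m
      apply hinj
      have h0 := LinearMap.congr_fun (hRB 0) m
      have h1 := LinearMap.congr_fun hT (T m)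
      simp only [TensorProduct.map_zero_left, LinearMap.zero_comp, LinearMap.zero_apply,
        LinearMap.add_apply, LinearMap.smul_apply, LinearMap.comp_apply, zero_add, neg_smul,
        one_smul] at h0 h1
      rw [h1, ← sub_eq_zero, sub_eq_add_neg, ← h0]
    have hproj : ∀ m₁ ∈ LinearMap.range T, ∀ m₂ ∈ LinearMap.range (LinearMap.id - T),
        T (m₁ + m₂) = m₁ := by
      rintro _ ⟨a, rfl⟩ _ ⟨b, rfl⟩
      simp [hTT]
    refine ⟨⟨?_, ?_⟩, isSubcomodule_range hT, isSubcomodule_range ?_, hproj⟩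
    · rw [Submodule.disjoint_def]
      intro x hx₁ hx₂
      have h1 := hproj x hx₁ 0 (Submodule.zero_mem _)
      have h2 := hproj 0 (Submodule.zero_mem _) x hx₂
      rw [add_zero] at h1
      rw [zero_add] at h2
      exact h1.symm.trans h2
    · rw [codisjoint_iff, Submodule.eq_top_iff']
      intro x
      exact Submodule.mem_sup.2 ⟨T x, ⟨x, rfl⟩, x - T x, ⟨x, rfl⟩, by abel⟩
    · have hsub : TensorProduct.map (LinearMap.id : C →ₗ[k] C) (LinearMap.id - T) =
          TensorProduct.map LinearMap.id LinearMap.id - TensorProduct.map LinearMap.id T :=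
        LinearMap.lTensor_sub LinearMap.id T
      rw [LinearMap.comp_sub, hT, hsub, LinearMap.sub_comp, TensorProduct.map_id,
        LinearMap.comp_id, LinearMap.id_comp]
  · intro M₁ M₂ hc h₁ h₂ hproj
    have hT₁ : ∀ m ∈ M₁, T m = m := fun m hm => by
      simpa using hproj m hm 0 M₂.zero_mem
    have hT₂ : ∀ m ∈ M₂, T m = 0 := fun m hm => by
      simpa using hproj 0 M₁.zero_mem m hm
    have hdecomp : ∀ m, ∃ a ∈ M₁, ∃ b ∈ M₂, a + b = m := fun m =>
      Submodule.mem_sup.1 (hc.sup_eq_top ▸ Submodule.mem_top)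
    have hT : ρ ∘ₗ T = TensorProduct.map LinearMap.id T ∘ₗ ρ := by
      ext m
      obtain ⟨a, ha, b, hb, rfl⟩ := hdecomp m
      simp only [LinearMap.comp_apply, map_add]
      rw [h₁.coaction_apply_of_eqOn (g := LinearMap.id) (by simp) hT₁ ha,
        h₂.coaction_apply_of_eqOn (g := 0) (by simp) hT₂ hb]
    have hTT : T ∘ₗ T = T := by
      ext m
      obtain ⟨a, ha, b, hb, rfl⟩ := hdecomp m
      rw [LinearMap.comp_apply, hproj a ha b hb, hT₁ a ha]
    refine ⟨hT, fun P => ?_⟩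
    have hP : TensorProduct.map P LinearMap.id ∘ₗ ρ ∘ₗ T = TensorProduct.map P T ∘ₗ ρ := by
      rw [hT, ← LinearMap.comp_assoc, ← TensorProduct.map_comp, LinearMap.comp_id,
        LinearMap.id_comp]
    have hid : TensorProduct.map LinearMap.id T ∘ₗ ρ ∘ₗ T = ρ ∘ₗ T := by
      rw [← LinearMap.comp_assoc, ← hT, LinearMap.comp_assoc, hTT]
    rw [RBPairedComodule, hP, hid, neg_one_smul k (ρ ∘ₗ T), add_neg_cancel_right]
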